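/- Let P ∈ ℝ with 1 ≤ P < 2 and set δ = (2 − P)/(1 − 2P). Let F : ℝ → ℝ be three times differentiable on [0,∞) with F''(x) > 0 for all x ≥ 0, satisfying the extended Blasius equation F'''(x)·(F''(x))^{P−1} + (1/2)·F(x)·F''(x) = 0 for all x ≥ 0, the initial conditions F(0) = 0, F'(0) = 0, F''(0) = 1, and suppose F'(x) → L as x → ∞ for some L > 0. Define λ = L^{1/(1−δ)} and f(η) = λ^{−1}·F(λ^{δ}·η). Then f is three times differentiable on [0,∞), f''(η) > 0 for all η ≥ 0, f satisfies f'''(η)·(f''(η))^{P−1} + (1/2)·f(η)·f''(η) = 0 for all η ≥ 0, f(0) = 0, f'(0) = 0, and f'(η) → 1 as η → ∞. Hence f solves the extended Blasius boundary value problem. -/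

import Mathlib

open Filter

theorem deriv_const_mul_comp_mul_left (a c : ℝ) (G : ℝ → ℝ) :
    deriv (fun x => a * G (c * x)) = fun x => a * c * deriv G (c * x) := by
  funext x
  rw [deriv_const_mul_field, deriv_comp_mul_left, smul_eq_mul, mul_assoc]

theorem DifferentiableAt.const_mul_comp_mul_left {G : ℝ → ℝ} {c x : ℝ}
    (hG : DifferentiableAt ℝ G (c * x)) (a : ℝ) :
    DifferentiableAt ℝ (fun y => a * G (c * y)) x :=
  (DifferentiableAt.comp x hG (differentiableAt_id.const_mul c)).const_mul a

/-- The non-iterative transformation method for the extended Blasius problem: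
if `F` solves the initial value problem `F'''·(F'')^{P-1} + (1/2)·F·F'' = 0`,
`F(0) = F'(0) = 0`, `F''(0) = 1`, with `F'(x) → L > 0` as `x → ∞`, then
`f(η) = λ^{-1}·F(λ^δ·η)` with `λ = L^{1/(1-δ)}`, `δ = (2-P)/(1-2P)`, solves the
extended Blasius boundary value problem. -/
theorem extended_blasius_nitm
    (P : ℝ) (hP1 : 1 ≤ P) (hP2 : P < 2)
    (δ : ℝ) (hδ : δ = (2 - P) / (1 - 2 * P))
    (F : ℝ → ℝ)
    (hF1 : ∀ x ∈ Set.Ici (0 : ℝ), DifferentiableAt ℝ F x)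
    (hF2 : ∀ x ∈ Set.Ici (0 : ℝ), DifferentiableAt ℝ (deriv F) x)
    (hF3 : ∀ x ∈ Set.Ici (0 : ℝ), DifferentiableAt ℝ (deriv (deriv F)) x)
    (hpos : ∀ x ∈ Set.Ici (0 : ℝ), 0 < deriv (deriv F) x)
    (heq : ∀ x ∈ Set.Ici (0 : ℝ),
      deriv (deriv (deriv F)) x * (deriv (deriv F) x) ^ (P - 1)
        + (1 / 2) * F x * deriv (deriv F) x = 0)
    (hF0 : F 0 = 0) (hF0' : deriv F 0 = 0) (hF0'' : deriv (deriv F) 0 = 1)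
    (L : ℝ) (hL : 0 < L)
    (hlim : Tendsto (deriv F) atTop (nhds L))
    (lam : ℝ) (hlam : lam = L ^ (1 / (1 - δ)))
    (f : ℝ → ℝ) (hf : f = fun η => lam ^ (-1 : ℝ) * F (lam ^ δ * η)) :
    (∀ η ∈ Set.Ici (0 : ℝ), DifferentiableAt ℝ f η) ∧
    (∀ η ∈ Set.Ici (0 : ℝ), DifferentiableAt ℝ (deriv f) η) ∧
    (∀ η ∈ Set.Ici (0 : ℝ), DifferentiableAt ℝ (deriv (deriv f)) η) ∧
    (∀ η ∈ Set.Ici (0 : ℝ), 0 < deriv (deriv f) η) ∧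
    (∀ η ∈ Set.Ici (0 : ℝ),
      deriv (deriv (deriv f)) η * (deriv (deriv f) η) ^ (P - 1)
        + (1 / 2) * f η * deriv (deriv f) η = 0) ∧
    f 0 = 0 ∧ deriv f 0 = 0 ∧
    Tendsto (deriv f) atTop (nhds 1) := by
  have hδ1 : δ < 0 := hδ ▸ div_neg_of_pos_of_neg (by linarith) (by linarith)
  have hδ2 : δ * (1 - 2 * P) = 2 - P := by
    rw [hδ, div_mul_cancel₀ _ (by linarith)]
  have hlam0 : 0 < lam := hlam ▸ Real.rpow_pos_of_pos hL _
  have hlamL : lam ^ (1 - δ) = L := by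
    rw [hlam, ← Real.rpow_mul hL.le, one_div_mul_cancel (by linarith), Real.rpow_one]
  have hd1 : deriv f = fun η => lam ^ (δ - 1) * deriv F (lam ^ δ * η) := by
    rw [hf, deriv_const_mul_comp_mul_left, ← Real.rpow_add hlam0]
    ring_nf
  have hd2 : deriv (deriv f) = fun η => lam ^ (2 * δ - 1) * deriv (deriv F) (lam ^ δ * η) := by
    rw [hd1, deriv_const_mul_comp_mul_left, ← Real.rpow_add hlam0]
    ring_nf
  have hd3 : deriv (deriv (deriv f)) =
      fun η => lam ^ (3 * δ - 1) * deriv (deriv (deriv F)) (lam ^ δ * η) := by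
    rw [hd2, deriv_const_mul_comp_mul_left, ← Real.rpow_add hlam0]
    ring_nf
  have hc : 0 < lam ^ δ := Real.rpow_pos_of_pos hlam0 δ
  have hmem : ∀ η ∈ Set.Ici (0 : ℝ), lam ^ δ * η ∈ Set.Ici (0 : ℝ) :=
    fun η hη => mul_nonneg hc.le hη
  refine ⟨fun η hη => ?_, fun η hη => ?_, fun η hη => ?_, fun η hη => ?_, fun η hη => ?_,
    ?_, ?_, ?_⟩
  · rw [hf]
    exact (hF1 _ (hmem η hη)).const_mul_comp_mul_left _
  · rw [hd1]
    exact (hF2 _ (hmem η hη)).const_mul_comp_mul_left _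
  · rw [hd2]
    exact (hF3 _ (hmem η hη)).const_mul_comp_mul_left _
  · rw [hd2]
    exact mul_pos (Real.rpow_pos_of_pos hlam0 _) (hpos _ (hmem η hη))
  · have hexp : lam ^ (3 * δ - 1) * lam ^ ((2 * δ - 1) * (P - 1)) =
        lam ^ (-1 : ℝ) * lam ^ (2 * δ - 1) := by
      rw [← Real.rpow_add hlam0, ← Real.rpow_add hlam0]
      congr 1
      linarith
    rw [hd3, hd2, hf]
    beta_reduce
    rw [Real.mul_rpow (Real.rpow_pos_of_pos hlam0 _).le (hpos _ (hmem η hη)).le,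
      ← Real.rpow_mul hlam0.le]
    linear_combination lam ^ (-1 : ℝ) * lam ^ (2 * δ - 1) * heq _ (hmem η hη) +
      deriv (deriv (deriv F)) (lam ^ δ * η) * deriv (deriv F) (lam ^ δ * η) ^ (P - 1) * hexp
  · simp [hf, hF0]
  · simp [hd1, hF0']
  · have hone : lam ^ (δ - 1) * L = 1 := by
      rw [← hlamL, ← Real.rpow_add hlam0, sub_add_sub_cancel, sub_self, Real.rpow_zero]
    have h := (hlim.comp (tendsto_id.const_mul_atTop hc)).const_mul (lam ^ (δ - 1))
    rw [hone] at h
    rw [hd1]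
    exact h
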